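/- Let 0 < r_j ≤ r_k. Then ∫_{x ∈ B̄(0, r_k)} vol(B̄(0, r_k) ∩ B̄(x, r_j)) dx = 2π·∫₀^{r_k} (φ₁(h)·r_j² + θ₁(h)·r_k² − h·r_j·sin φ₁(h))·h dh, where φ₁(h) = arccos((h² + r_j² − r_k²)/(2·h·r_j)) and θ₁(h) = arccos((h² + r_k² − r_j²)/(2·h·r_k)). Consequently, the cluster coefficient of Case I, i.e. the average over x uniform in B̄(0, r_k) of vol(B̄(0, r_k) ∩ B̄(x, r_j))/(π r_k²), equals (2/(π r_k⁴))·∫₀^{r_k} (φ₁(h) r_j² + θ₁(h) r_k² − h r_j sin φ₁(h)) h dh. -/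

import Mathlib

open MeasureTheory Metric Real

theorem hasDerivAt_circularSegment {R x : ℝ} (hR : 0 < R) (h₁ : x ≠ -R) (h₂ : x ≠ R) :
    HasDerivAt (fun t => t * √(R ^ 2 - t ^ 2) - R ^ 2 * arccos (t / R))
      (2 * √(R ^ 2 - x ^ 2)) x := by
  have hA : R ^ 2 - x ^ 2 ≠ 0 := by
    rw [sq_sub_sq]
    exact mul_ne_zero (fun h => h₁ (by linarith)) (fun h => h₂ (by linarith))
  have hs : HasDerivAt (fun t => √(R ^ 2 - t ^ 2)) (-(2 * x) / (2 * √(R ^ 2 - x ^ 2))) x := by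
    have h := (((hasDerivAt_id x).pow 2).const_sub (R ^ 2)).sqrt hA
    simpa using h
  have ha : HasDerivAt (fun t => arccos (t / R)) (-(1 / √(1 - (x / R) ^ 2)) * (1 / R)) x := by
    have hne₁ : x / R ≠ -1 := by
      rw [Ne, div_eq_iff hR.ne']; simpa using h₁
    have hne₂ : x / R ≠ 1 := by
      rw [Ne, div_eq_iff hR.ne']; simpa using h₂
    exact HasDerivAt.comp (h₂ := arccos) (h := fun t => t / R) x
      (Real.hasDerivAt_arccos hne₁ hne₂) ((hasDerivAt_id x).div_const R)
  have hroot : √(1 - (x / R) ^ 2) = √(R ^ 2 - x ^ 2) / R := by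
    rw [show 1 - (x / R) ^ 2 = (R ^ 2 - x ^ 2) / R ^ 2 by field_simp,
      Real.sqrt_div' _ (sq_nonneg R), Real.sqrt_sq hR.le]
  refine (((hasDerivAt_id x).mul hs).sub (ha.const_mul (R ^ 2))).congr_deriv ?_
  rw [hroot]
  rcases lt_or_gt_of_ne hA with hneg | hpos
  · simp [Real.sqrt_eq_zero_of_nonpos hneg.le]
  · have hS := Real.sqrt_pos.2 hpos
    have hsq := Real.sq_sqrt hpos.le
    simp only [id]
    field_simp
    linarith

theorem integral_circularSegment {R d M : ℝ} (hR : 0 < R) (hd : d ≤ M) (hM : R ≤ M) :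
    ∫ x in d..M, 2 * √(R ^ 2 - x ^ 2) = R ^ 2 * arccos (d / R) - d * √(R ^ 2 - d ^ 2) := by
  rw [integral_eq_of_hasDerivAt_off_countable_of_le
    (fun t => t * √(R ^ 2 - t ^ 2) - R ^ 2 * arccos (t / R)) _ hd
    (Set.Countable.insert (-R) (Set.countable_singleton R)) (by fun_prop)
    (fun x hx => hasDerivAt_circularSegment hR (fun h => hx.2 (by simp [h]))
      (fun h => hx.2 (by simp [h])))
    ((by fun_prop : Continuous fun x : ℝ => 2 * √(R ^ 2 - x ^ 2)).intervalIntegrable _ _)]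
  rw [Real.arccos_of_one_le ((one_le_div hR).2 hM),
    Real.sqrt_eq_zero_of_nonpos (by nlinarith : R ^ 2 - M ^ 2 ≤ 0)]
  ring

theorem volume_circularSegment {R d : ℝ} (hR : 0 < R) {s : Set ℝ} (hs : MeasurableSet s)
    (hsd : s =ᵐ[volume] Set.Ioi d) :
    volume {p : ℝ × ℝ | p.1 ∈ s ∧ p.1 ^ 2 + p.2 ^ 2 ≤ R ^ 2} =
      ENNReal.ofReal (R ^ 2 * arccos (d / R) - d * √(R ^ 2 - d ^ 2)) := by
  have hmeas : MeasurableSet {p : ℝ × ℝ | p.1 ∈ s ∧ p.1 ^ 2 + p.2 ^ 2 ≤ R ^ 2} :=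
    (measurable_fst hs).inter
      (measurableSet_le (f := fun p : ℝ × ℝ => p.1 ^ 2 + p.2 ^ 2) (by fun_prop) measurable_const)
  have hslice (x : ℝ) :
      volume (Prod.mk x ⁻¹' {p : ℝ × ℝ | p.1 ∈ s ∧ p.1 ^ 2 + p.2 ^ 2 ≤ R ^ 2}) =
        s.indicator (fun x => ENNReal.ofReal (2 * √(R ^ 2 - x ^ 2))) x := by
    by_cases hx : x ∈ s
    · rw [Set.indicator_of_mem hx]
      rcases lt_or_ge (R ^ 2 - x ^ 2) 0 with hneg | hpos
      · have : Prod.mk x ⁻¹' {p : ℝ × ℝ | p.1 ∈ s ∧ p.1 ^ 2 + p.2 ^ 2 ≤ R ^ 2} = ∅ := by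
          ext y
          simp only [Set.mem_preimage, Set.mem_ofPred_eq, Set.mem_empty_iff_false, iff_false]
          exact fun h => by nlinarith [h.2, sq_nonneg y]
        simp [this, Real.sqrt_eq_zero_of_nonpos hneg.le]
      · have : Prod.mk x ⁻¹' {p : ℝ × ℝ | p.1 ∈ s ∧ p.1 ^ 2 + p.2 ^ 2 ≤ R ^ 2} =
            Set.Icc (-√(R ^ 2 - x ^ 2)) (√(R ^ 2 - x ^ 2)) := by
          ext y
          rw [Set.mem_Icc, ← abs_le, Real.le_sqrt (abs_nonneg y) hpos, sq_abs]
          simp only [Set.mem_preimage, Set.mem_ofPred_eq, hx, true_and]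
          exact le_sub_iff_add_le'.symm
        rw [this, Real.volume_Icc]
        congr 1
        ring
    · simp [hx]
  have hunion : Set.Ioi d = Set.Ioc d (max d R) ∪ Set.Ioi (max d R) :=
    (Set.Ioc_union_Ioi_eq_Ioi (le_max_left d R)).symm
  have hzero : ∫⁻ x in Set.Ioi (max d R), ENNReal.ofReal (2 * √(R ^ 2 - x ^ 2)) = 0 := by
    refine setLIntegral_eq_zero measurableSet_Ioi fun x hx => ?_
    have hRx : R < x := (le_max_right d R).trans_lt hx
    simp [Real.sqrt_eq_zero_of_nonpos (by nlinarith : R ^ 2 - x ^ 2 ≤ 0)]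
  rw [Measure.volume_eq_prod, Measure.prod_apply hmeas, lintegral_congr hslice,
    lintegral_indicator hs, Measure.restrict_congr_set hsd,
    ← integral_circularSegment hR (le_max_left d R) (le_max_right d R),
    intervalIntegral.integral_of_le (le_max_left d R),
    ofReal_integral_eq_lintegral_ofReal]
  · rw [hunion, lintegral_union measurableSet_Ioi (Set.Ioc_disjoint_Ioi le_rfl), hzero, add_zero]
  · exact ((by fun_prop : Continuous fun x : ℝ => 2 * √(R ^ 2 - x ^ 2)).integrableOn_Icc).mono_set
      Set.Ioc_subset_Icc_self
  · exact Filter.Eventually.of_forall fun x => by positivity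

theorem circularSegment_nonneg {R d : ℝ} (hR : 0 < R) :
    0 ≤ R ^ 2 * arccos (d / R) - d * √(R ^ 2 - d ^ 2) := by
  rw [← integral_circularSegment hR (le_max_left d R) (le_max_right d R)]
  exact intervalIntegral.integral_nonneg (le_max_left d R) fun x _ => by positivity

/-- The area of the lens cut out by two discs of radii `R` and `r` whose centres are at
distance `h`. -/
noncomputable def lensArea (R r h : ℝ) : ℝ :=
  arccos ((h ^ 2 + r ^ 2 - R ^ 2) / (2 * h * r)) * r ^ 2 +
    arccos ((h ^ 2 + R ^ 2 - r ^ 2) / (2 * h * R)) * R ^ 2 -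
    h * r * sin (arccos ((h ^ 2 + r ^ 2 - R ^ 2) / (2 * h * r)))

theorem volume_lens {R r h : ℝ} (hR : 0 < R) (hr : 0 < r) (hh : 0 < h) :
    (volume {p : ℝ × ℝ | p.1 ^ 2 + p.2 ^ 2 ≤ R ^ 2 ∧
      (p.1 - h) ^ 2 + p.2 ^ 2 ≤ r ^ 2}).toReal = lensArea R r h := by
  -- `d` is the abscissa of the radical axis of the two circles.
  obtain ⟨d, hd⟩ : ∃ d, d = (h ^ 2 + R ^ 2 - r ^ 2) / (2 * h) := ⟨_, rfl⟩
  have hdh : 2 * h * d = h ^ 2 + R ^ 2 - r ^ 2 := by rw [hd]; field_simp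
  have hright : {p : ℝ × ℝ | p.1 ^ 2 + p.2 ^ 2 ≤ R ^ 2 ∧ (p.1 - h) ^ 2 + p.2 ^ 2 ≤ r ^ 2} ∩
      {p | d < p.1} = {p | p.1 ∈ Set.Ioi d ∧ p.1 ^ 2 + p.2 ^ 2 ≤ R ^ 2} := by
    ext p
    simp only [Set.mem_inter_iff, Set.mem_ofPred_eq, Set.mem_Ioi]
    exact ⟨fun hp => ⟨hp.2, hp.1.1⟩, fun hp => ⟨⟨hp.2, by nlinarith⟩, hp.1⟩⟩
  have hleft : {p : ℝ × ℝ | p.1 ^ 2 + p.2 ^ 2 ≤ R ^ 2 ∧ (p.1 - h) ^ 2 + p.2 ^ 2 ≤ r ^ 2} \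
      {p | d < p.1} = Prod.map (fun x => h - x) id ⁻¹'
        {p | p.1 ∈ Set.Ici (h - d) ∧ p.1 ^ 2 + p.2 ^ 2 ≤ r ^ 2} := by
    ext p
    simp only [Set.mem_sdiff, Set.mem_ofPred_eq, Set.mem_Ici, Set.mem_preimage, Prod.map_fst,
      Prod.map_snd, id, not_lt]
    exact ⟨fun hp => ⟨by linarith, by nlinarith [hp.1.2]⟩,
      fun hp => ⟨⟨by nlinarith, by nlinarith⟩, by linarith [hp.1]⟩⟩
  have hmeas : MeasurableSet {p : ℝ × ℝ | p.1 ∈ Set.Ici (h - d) ∧ p.1 ^ 2 + p.2 ^ 2 ≤ r ^ 2} :=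
    (measurable_fst measurableSet_Ici).inter
      (measurableSet_le (f := fun p : ℝ × ℝ => p.1 ^ 2 + p.2 ^ 2) (by fun_prop) measurable_const)
  have hreflect : MeasurePreserving (Prod.map (fun x : ℝ => h - x) (id : ℝ → ℝ)) volume volume :=
    (Measure.measurePreserving_sub_left volume h).prod (MeasurePreserving.id volume)
  rw [← measure_inter_add_sdiff _ (measurableSet_lt measurable_const measurable_fst :
      MeasurableSet {p : ℝ × ℝ | d < p.1}), hright, hleft,
    hreflect.measure_preimage hmeas.nullMeasurableSet,
    volume_circularSegment hR measurableSet_Ioi Filter.EventuallyEq.rfl,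
    volume_circularSegment hr measurableSet_Ici Ioi_ae_eq_Ici.symm,
    ← ENNReal.ofReal_add (circularSegment_nonneg hR) (circularSegment_nonneg hr),
    ENNReal.toReal_ofReal (add_nonneg (circularSegment_nonneg hR) (circularSegment_nonneg hr)),
    lensArea, Real.sin_arccos]
  have hφ : (h ^ 2 + r ^ 2 - R ^ 2) / (2 * h * r) = (h - d) / r := by
    rw [hd]; field_simp; ring
  have hθ : (h ^ 2 + R ^ 2 - r ^ 2) / (2 * h * R) = d / R := by
    rw [hd]; field_simp
  have hchord : R ^ 2 - d ^ 2 = r ^ 2 - (h - d) ^ 2 := by linarith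
  have hroot : √(1 - ((h - d) / r) ^ 2) = √(r ^ 2 - (h - d) ^ 2) / r := by
    rw [show 1 - ((h - d) / r) ^ 2 = (r ^ 2 - (h - d) ^ 2) / r ^ 2 by field_simp,
      Real.sqrt_div' _ (sq_nonneg r), Real.sqrt_sq hr.le]
  rw [hφ, hθ, hroot, hchord]
  field_simp
  ring

theorem volume_closedBall_inter_closedBall {R r : ℝ} (hR : 0 < R) (hr : 0 < r)
    {x : EuclideanSpace ℝ (Fin 2)} (hx : x ≠ 0) :
    (volume (closedBall 0 R ∩ closedBall x r)).toReal = lensArea R r ‖x‖ := by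
  have hnorm : 0 < ‖x‖ := norm_pos_iff.2 hx
  obtain ⟨b, hb⟩ := Orthonormal.exists_orthonormalBasis_extension_of_card_eq (𝕜 := ℝ)
    (E := EuclideanSpace ℝ (Fin 2)) (ι := Fin 2) (by simp)
    (v := fun _ => ‖x‖⁻¹ • x) (s := {0}) (by
      constructor
      · intro i
        simp [norm_smul, hnorm.ne']
      · intro i j hij
        exact absurd (Subsingleton.elim i j) hij)
  have hb₀ : x = ‖x‖ • b 0 := by
    rw [hb 0 rfl, smul_inv_smul₀ hnorm.ne']
  have hx₀ : b.repr x 0 = ‖x‖ := by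
    conv_lhs => rw [hb₀]
    simp
  have hx₁ : b.repr x 1 = 0 := by
    conv_lhs => rw [hb₀]
    simp
  have hpres : MeasurePreserving
      (fun y : EuclideanSpace ℝ (Fin 2) => (b.repr y 0, b.repr y 1)) volume volume :=
    (volume_preserving_finTwoArrow ℝ).comp
      ((PiLp.volume_preserving_ofLp (Fin 2)).comp b.measurePreserving_repr)
  have hmeas : MeasurableSet {p : ℝ × ℝ | p.1 ^ 2 + p.2 ^ 2 ≤ R ^ 2 ∧
      (p.1 - ‖x‖) ^ 2 + p.2 ^ 2 ≤ r ^ 2} :=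
    (measurableSet_le (f := fun p : ℝ × ℝ => p.1 ^ 2 + p.2 ^ 2) (by fun_prop)
      measurable_const).inter
      (measurableSet_le (f := fun p : ℝ × ℝ => (p.1 - ‖x‖) ^ 2 + p.2 ^ 2) (by fun_prop)
        measurable_const)
  rw [← volume_lens hR hr hnorm, ← hpres.measure_preimage hmeas.nullMeasurableSet]
  congr 2
  ext y
  simp only [Set.mem_inter_iff, mem_closedBall, Set.mem_preimage, Set.mem_ofPred_eq]
  rw [← b.repr.dist_map y x, ← b.repr.dist_map y 0, EuclideanSpace.dist_eq,
    EuclideanSpace.dist_eq, Real.sqrt_le_left hR.le, Real.sqrt_le_left hr.le]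
  simp [Fin.sum_univ_two, Real.dist_eq, sq_abs, hx₀, hx₁]

theorem integral_volume_closedBall_inter_closedBall {R r : ℝ} (hR : 0 < R) (hr : 0 < r) :
    ∫ x in closedBall (0 : EuclideanSpace ℝ (Fin 2)) R,
        (volume (closedBall (0 : EuclideanSpace ℝ (Fin 2)) R ∩ closedBall x r)).toReal =
      2 * π * ∫ h in (0 : ℝ)..R, lensArea R r h * h := by
  have hradial : (closedBall (0 : EuclideanSpace ℝ (Fin 2)) R).indicator (fun x =>
        (volume (closedBall (0 : EuclideanSpace ℝ (Fin 2)) R ∩ closedBall x r)).toReal)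
      =ᵐ[volume] fun x => (Set.Iic R).indicator (lensArea R r) ‖x‖ := by
    filter_upwards [Measure.ae_ne volume (0 : EuclideanSpace ℝ (Fin 2))] with x hx
    simp only [Set.indicator, mem_closedBall_zero_iff, Set.mem_Iic,
      volume_closedBall_inter_closedBall hR hr hx]
  have hball : (volume : Measure (EuclideanSpace ℝ (Fin 2))).real (ball 0 1) = π := by
    simp [Measure.real, pi_nonneg]
  rw [← integral_indicator measurableSet_closedBall, integral_congr_ae hradial,
    integral_fun_norm_addHaar, hball, intervalIntegral.integral_of_le hR.le]
  have hswap (y : ℝ) : y ^ (Module.finrank ℝ (EuclideanSpace ℝ (Fin 2)) - 1) •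
      (Set.Iic R).indicator (lensArea R r) y =
      (Set.Iic R).indicator (fun h => lensArea R r h * h) y := by
    by_cases hy : y ∈ Set.Iic R <;> simp [hy, mul_comm]
  simp_rw [hswap]
  rw [setIntegral_indicator measurableSet_Iic, Set.Ioi_inter_Iic]
  simp
  ring

/-- For `0 < r_j ≤ r_k`,
`∫_{x ∈ B̄(0, r_k)} vol(B̄(0, r_k) ∩ B̄(x, r_j)) dx
  = 2π ∫₀^{r_k} (φ₁(h) r_j² + θ₁(h) r_k² − h r_j sin φ₁(h)) h dh`,
and consequently the average over `x` uniform in `B̄(0, r_k)` of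
`vol(B̄(0, r_k) ∩ B̄(x, r_j))/(π r_k²)` (the Case I cluster coefficient) equals
`(2/(π r_k⁴)) ∫₀^{r_k} (φ₁(h) r_j² + θ₁(h) r_k² − h r_j sin φ₁(h)) h dh`. -/
theorem cluster_coefficient_case_I (rj rk : ℝ) (hrj : 0 < rj) (hjk : rj ≤ rk)
    (φ₁ θ₁ : ℝ → ℝ)
    (hφ₁ : ∀ h : ℝ, φ₁ h = Real.arccos ((h ^ 2 + rj ^ 2 - rk ^ 2) / (2 * h * rj)))
    (hθ₁ : ∀ h : ℝ, θ₁ h = Real.arccos ((h ^ 2 + rk ^ 2 - rj ^ 2) / (2 * h * rk))) :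
    (∫ x in closedBall (0 : EuclideanSpace ℝ (Fin 2)) rk,
        (volume (closedBall (0 : EuclideanSpace ℝ (Fin 2)) rk ∩ closedBall x rj)).toReal)
      = 2 * Real.pi *
          ∫ h in (0 : ℝ)..rk,
            (φ₁ h * rj ^ 2 + θ₁ h * rk ^ 2 - h * rj * Real.sin (φ₁ h)) * h ∧
    (Real.pi * rk ^ 2)⁻¹ *
        (∫ x in closedBall (0 : EuclideanSpace ℝ (Fin 2)) rk,
          (volume (closedBall (0 : EuclideanSpace ℝ (Fin 2)) rk ∩ closedBall x rj)).toReal /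
            (Real.pi * rk ^ 2))
      = (2 / (Real.pi * rk ^ 4)) *
          ∫ h in (0 : ℝ)..rk,
            (φ₁ h * rj ^ 2 + θ₁ h * rk ^ 2 - h * rj * Real.sin (φ₁ h)) * h := by
  have hrk : 0 < rk := hrj.trans_le hjk
  have hmain := integral_volume_closedBall_inter_closedBall hrk hrj
  simp only [lensArea, ← hφ₁, ← hθ₁] at hmain
  refine ⟨hmain, ?_⟩
  rw [integral_div, hmain]
  generalize (∫ h in (0 : ℝ)..rk,
    (φ₁ h * rj ^ 2 + θ₁ h * rk ^ 2 - h * rj * Real.sin (φ₁ h)) * h) = I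
  field_simp
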